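/- Let X be a paracompact Hausdorff finite C-space, Y a Hausdorff topological space, and φ_k : X ⇝ Y (k < ω) an aspherical sequence of lower locally constant set-valued mappings. Then there exists an n < ω such that φ_n has a continuous selection. -/

import Mathlib

/-- `EmbedIn k S B` means `S ↪_k B`: every continuous map from the unit `k`-sphere of
`ℝ^{k+1}` into `S` extends to a continuous map from the closed unit `(k+1)`-ball into `B`. -/
def EmbedIn {Y : Type*} [TopologicalSpace Y] (k : ℕ) (S B : Set Y) : Prop :=
  ∀ f : (Metric.sphere (0 : EuclideanSpace ℝ (Fin (k + 1))) 1) → Y,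
    Continuous f → Set.range f ⊆ S →
      ∃ g : (Metric.closedBall (0 : EuclideanSpace ℝ (Fin (k + 1))) 1) → Y,
        Continuous g ∧ Set.range g ⊆ B ∧
          ∀ z, g (Set.inclusion Metric.sphere_subset_closedBall z) = f z

/-- A set-valued mapping `Φ : X ⇝ Y` is lower locally constant if
`{x | K ⊆ Φ x}` is open for every compact `K ⊆ Y`. -/
def LowerLocallyConstant {X Y : Type*} [TopologicalSpace X] [TopologicalSpace Y]
    (Φ : X → Set Y) : Prop :=
  ∀ K : Set Y, IsCompact K → IsOpen {x | K ⊆ Φ x}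

/-- `X` is a finite C-space. -/
def IsFiniteCSpace (X : Type*) [TopologicalSpace X] : Prop :=
  ∀ U : ℕ → Set (Set X),
    (∀ n, (∀ u ∈ U n, IsOpen u) ∧ (U n).Finite ∧ ⋃₀ U n = Set.univ) →
      ∃ n : ℕ, ∃ V : ℕ → Set (Set X),
        (∀ k, k ≤ n → ∀ v ∈ V k, IsOpen v) ∧
        (∀ k, k ≤ n → (V k).Pairwise Disjoint) ∧
        (∀ k, k ≤ n → ∀ v ∈ V k, ∃ u ∈ U k, v ⊆ u) ∧
        (⋃ k ≤ n, ⋃₀ V k) = Set.univ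

open Set Topology Function

/-- `DisjointlyCovers U m M Z`: for each index `k ∈ [m, M)` the family `U k` has an open
pairwise disjoint shrinking such that all these shrinkings together cover `Z`. -/
def DisjointlyCovers {X ι : Type*} [TopologicalSpace X] (U : ℕ → ι → Set X) (m M : ℕ)
    (Z : Set X) : Prop :=
  ∃ D : ℕ → ι → Set X, (∀ k i, IsOpen (D k i)) ∧ (∀ k i, D k i ⊆ U k i) ∧
    (∀ k i j, i ≠ j → Disjoint (D k i) (D k j)) ∧ ∀ x ∈ Z, ∃ k, m ≤ k ∧ k < M ∧ ∃ i, x ∈ D k i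

/-- A form of covering dimension `< n` of `A` in `X`, tested on `n` two-element open covers. -/
def PairDimLT {X : Type*} [TopologicalSpace X] (n : ℕ) (A : Set X) : Prop :=
  ∀ U : ℕ → Bool → Set X, (∀ k b, IsOpen (U k b)) → (∀ k x, ∃ b, x ∈ U k b) →
    DisjointlyCovers U 0 n A

section DisjointlyCovers

variable {X ι : Type*} [TopologicalSpace X]

theorem DisjointlyCovers.union {U : ℕ → ι → Set X} {m M N : ℕ} {Z Z' : Set X}
    (h : DisjointlyCovers U m M Z) (h' : DisjointlyCovers U M N Z') (hmM : m ≤ M) (hMN : M ≤ N) :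
    DisjointlyCovers U m N (Z ∪ Z') := by
  obtain ⟨D, ho, hs, hd, hc⟩ := h
  obtain ⟨D', ho', hs', hd', hc'⟩ := h'
  refine ⟨fun k => if k < M then D k else D' k, fun k i => ?_, fun k i => ?_, fun k i j hij => ?_,
    ?_⟩
  · by_cases hk : k < M <;> simp [hk, ho, ho']
  · by_cases hk : k < M <;> simp [hk, hs, hs']
  · by_cases hk : k < M
    · simpa [hk] using hd k i j hij
    · simpa [hk] using hd' k i j hij
  · rintro x (hx | hx)
    · obtain ⟨k, h1, h2, i, hi⟩ := hc x hx
      exact ⟨k, h1, by omega, i, by simpa [h2] using hi⟩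
    · obtain ⟨k, h1, h2, i, hi⟩ := hc' x hx
      exact ⟨k, by omega, h2, i, by simpa [not_lt.2 h1] using hi⟩

theorem DisjointlyCovers.mono {U : ℕ → ι → Set X} {m M : ℕ} {Z Z' : Set X}
    (h : DisjointlyCovers U m M Z) (hZ : Z' ⊆ Z) : DisjointlyCovers U m M Z' := by
  obtain ⟨D, ho, hs, hd, hc⟩ := h
  exact ⟨D, ho, hs, hd, fun x hx => hc x (hZ hx)⟩

theorem disjointlyCovers_empty (U : ℕ → ι → Set X) (m M : ℕ) : DisjointlyCovers U m M ∅ :=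
  ⟨fun _ _ => ∅, by simp⟩

theorem PairDimLT.mono_set {n : ℕ} {A B : Set X} (h : PairDimLT n A) (hB : B ⊆ A) :
    PairDimLT n B := fun U ho hc => (h U ho hc).mono hB

theorem PairDimLT.mono {n m : ℕ} {A : Set X} (h : PairDimLT n A) (hnm : n ≤ m) :
    PairDimLT m A := fun U ho hc => by
  simpa using (h U ho hc).union (disjointlyCovers_empty U n m) (Nat.zero_le n) hnm

theorem pairDimLT_empty (n : ℕ) : PairDimLT n (∅ : Set X) :=
  fun U _ _ => disjointlyCovers_empty U 0 n

/-- The finite C-property for indexed covers with finite range. -/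
theorem IsFiniteCSpace.disjointlyCovers (hX : IsFiniteCSpace X) (U : ℕ → ι → Set X)
    (ho : ∀ k i, IsOpen (U k i)) (hc : ∀ k x, ∃ i, x ∈ U k i) (hf : ∀ k, (range (U k)).Finite) :
    ∃ n, DisjointlyCovers U 0 n univ := by
  classical
  obtain ⟨n, V, hVo, hVd, hVr, hVc⟩ := hX (fun k => range (U k)) (fun k => by
    refine ⟨?_, hf k, ?_⟩
    · rintro _ ⟨i, rfl⟩
      exact ho k i
    · refine eq_univ_of_forall fun x => ?_
      obtain ⟨i, hi⟩ := hc k x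
      exact ⟨U k i, mem_range_self i, hi⟩)
  rcases isEmpty_or_nonempty X with hE | ⟨⟨x₀⟩⟩
  · exact ⟨0, fun _ _ => ∅, by simp, by simp, by simp, fun x => hE.elim x⟩
  obtain ⟨i₀, -⟩ := hc 0 x₀
  have hsel : ∀ k, ∀ v : Set X, ∃ i, k ≤ n → v ∈ V k → v ⊆ U k i := by
    intro k v
    by_cases h : k ≤ n ∧ v ∈ V k
    · obtain ⟨_, ⟨i, rfl⟩, hi⟩ := hVr k h.1 v h.2
      exact ⟨i, fun _ _ => hi⟩
    · exact ⟨i₀, fun h1 h2 => absurd ⟨h1, h2⟩ h⟩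
  choose s hs using hsel
  refine ⟨n + 1, fun k i => ⋃₀ {v | k ≤ n ∧ v ∈ V k ∧ s k v = i}, ?_, ?_, ?_, ?_⟩
  · exact fun k i => isOpen_sUnion fun v hv => hVo k hv.1 v hv.2.1
  · rintro k i
    refine sUnion_subset ?_
    rintro v ⟨h1, h2, rfl⟩
    exact hs k v h1 h2
  · intro k i j hij
    rw [Set.disjoint_left]
    rintro x ⟨v, ⟨h1, h2, h3⟩, hxv⟩ ⟨w, ⟨h4, h5, h6⟩, hxw⟩
    have : v ≠ w := by
      rintro rfl
      exact hij (h3.symm.trans h6)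
    exact Set.disjoint_left.1 (hVd k h1 h2 h5 this) hxv hxw
  · intro x _
    have hx : x ∈ ⋃ k ≤ n, ⋃₀ V k := hVc ▸ mem_univ x
    simp only [mem_iUnion, mem_sUnion] at hx
    obtain ⟨k, hk, v, hv, hxv⟩ := hx
    exact ⟨k, Nat.zero_le k, by omega, s k v, v, ⟨hk, hv, rfl⟩, hxv⟩

/-- In a finite C-space a locally finite sequence of pairwise disjoint closed sets cannot have
dimensions growing to infinity. -/
theorem IsFiniteCSpace.exists_pairDimLT (hX : IsFiniteCSpace X) {A : ℕ → Set X}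
    (hA : ∀ i, IsClosed (A i)) (hlf : LocallyFinite A)
    (hd : ∀ i j, i ≠ j → Disjoint (A i) (A j)) : ∃ i, PairDimLT i (A i) := by
  by_contra! hcon
  simp only [PairDimLT, not_forall] at hcon
  choose U ho hc hbad using hcon
  obtain ⟨n, D, hDo, hDs, hDd, hDc⟩ := hX.disjointlyCovers
    (fun k b => (⋃ i, A i \ U i k b)ᶜ)
    (fun k b => by
      refine isOpen_compl_iff.2 ?_
      exact (hlf.subset fun i => sdiff_subset).isClosed_iUnion
        fun i => (hA i).sdiff (ho i k b))
    (fun k x => by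
      by_contra! hx
      have h1 := hx true
      have h2 := hx false
      simp only [mem_compl_iff, not_not, mem_iUnion] at h1 h2
      obtain ⟨i, hi, hi'⟩ := h1
      obtain ⟨j, hj, hj'⟩ := h2
      have hij : i = j := by
        by_contra hne
        exact Set.disjoint_left.1 (hd i j hne) hi hj
      subst hij
      obtain ⟨b, hb⟩ := hc i k x
      cases b
      · exact hj' hb
      · exact hi' hb)
    (fun k => toFinite _)
  refine hbad n ⟨fun k b => D k b ∩ U n k b, fun k b => (hDo k b).inter (ho n k b),
    fun k b => inter_subset_right, fun k i j hij => (hDd k i j hij).mono inter_subset_left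
      inter_subset_left, fun x hx => ?_⟩
  obtain ⟨k, h1, h2, b, hb⟩ := hDc x (mem_univ x)
  refine ⟨k, h1, h2, b, hb, ?_⟩
  by_contra hxU
  exact hDs k b hb (mem_iUnion.2 ⟨n, hx, hxU⟩)

theorem PairDimLT.exists_finset {n : ℕ} {A : Set X} (h : PairDimLT n A) (J : Finset ι)
    (hJ : J.card = n) (C E : ι → Set X) (hC : ∀ j, IsOpen (C j)) (hE : ∀ j, IsOpen (E j))
    (hCE : ∀ j ∈ J, ∀ x, x ∈ C j ∨ x ∈ E j) :
    ∃ P Q : ι → Set X, (∀ j, IsOpen (P j)) ∧ (∀ j, IsOpen (Q j)) ∧ (∀ j, P j ⊆ C j) ∧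
      (∀ j, Q j ⊆ E j) ∧ (∀ j, Disjoint (P j) (Q j)) ∧
      ∀ x ∈ A, ∃ j ∈ J, x ∈ P j ∨ x ∈ Q j := by
  classical
  subst hJ
  let e := J.equivFin
  obtain ⟨D, hDo, hDs, hDd, hDc⟩ := h
    (fun k b => if hk : k < J.card then
      (if b then C (e.symm ⟨k, hk⟩) else E (e.symm ⟨k, hk⟩)) else univ)
    (fun k b => by
      by_cases hk : k < J.card <;> cases b <;> simp [hk, hC, hE])
    (fun k x => by
      by_cases hk : k < J.card
      · rcases hCE (e.symm ⟨k, hk⟩) (e.symm ⟨k, hk⟩).2 x with hx | hx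
        · exact ⟨true, by simpa [hk] using hx⟩
        · exact ⟨false, by simpa [hk] using hx⟩
      · exact ⟨true, by simp [hk]⟩)
  refine ⟨fun j => if hj : j ∈ J then D (e ⟨j, hj⟩) true else ∅,
    fun j => if hj : j ∈ J then D (e ⟨j, hj⟩) false else ∅, fun j => ?_, fun j => ?_, fun j => ?_,
    fun j => ?_, fun j => ?_, fun x hx => ?_⟩
  · by_cases hj : j ∈ J <;> simp [hj, hDo]
  · by_cases hj : j ∈ J <;> simp [hj, hDo]
  · by_cases hj : j ∈ J
    · simpa [hj] using hDs (e ⟨j, hj⟩) true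
    · simp [hj]
  · by_cases hj : j ∈ J
    · simpa [hj] using hDs (e ⟨j, hj⟩) false
    · simp [hj]
  · by_cases hj : j ∈ J
    · simpa [hj] using hDd (e ⟨j, hj⟩) true false (by simp)
    · simp [hj]
  · obtain ⟨k, -, hk, b, hb⟩ := hDc x hx
    refine ⟨e.symm ⟨k, hk⟩, (e.symm ⟨k, hk⟩).2, ?_⟩
    cases b
    · right; simpa using hb
    · left; simpa using hb

end DisjointlyCovers

section OrderReduction

variable {X ι : Type*} [TopologicalSpace X]

/-- Over a closed set of dimension `< n`, an open cover can be shrunk so that `n + 1` prescribed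
members have no common point there, without changing it elsewhere. -/
theorem PairDimLT.exists_shrinking [NormalSpace X] {n : ℕ} {E Z : Set X} (h : PairDimLT n E)
    (hE : IsClosed E) (hEZ : E ⊆ Z) (J : Finset ι) (hJ : J.card = n + 1) (W : ι → Set X)
    (hW : ∀ t, IsOpen (W t)) (hZ : ∀ x ∈ Z, ∃ t, x ∈ W t) :
    ∃ W' : ι → Set X, (∀ t, IsOpen (W' t)) ∧ (∀ t, W' t ⊆ W t) ∧ (∀ x ∈ Z, ∃ t, x ∈ W' t) ∧
      (∀ x ∉ E, ∀ t, x ∈ W t → x ∈ W' t) ∧ ∀ x ∈ E, ∃ t ∈ J, x ∉ W' t := by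
  classical
  obtain ⟨s, hs⟩ : J.Nonempty := by
    rw [← Finset.card_pos]
    omega
  set J₀ := J.erase s with hJ₀
  have hcard : J₀.card = n := by
    rw [hJ₀, Finset.card_erase_of_mem hs]
    omega
  let G : Option J₀ → Set X := fun o => o.elim (⋃ t ∈ {t | t ∉ J₀}, W t) fun j => W j
  obtain ⟨H, hEH, hHo, hHG⟩ := exists_subset_iUnion_closure_subset (u := G) hE
    (by
      rintro (_ | j)
      · exact isOpen_biUnion fun t _ => hW t
      · exact hW j)
    (fun _ _ => toFinite _)
    (by
      intro x hx
      obtain ⟨t, ht⟩ := hZ x (hEZ hx)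
      by_cases htJ : t ∈ J₀
      · exact mem_iUnion.2 ⟨some ⟨t, htJ⟩, ht⟩
      · exact mem_iUnion.2 ⟨none, mem_biUnion (show t ∈ {t | t ∉ J₀} from htJ) ht⟩)
  let H' : ι → Set X := fun t => if ht : t ∈ J₀ then H (some ⟨t, ht⟩) else ∅
  have hH'o : ∀ t, IsOpen (H' t) := fun t => by
    by_cases ht : t ∈ J₀ <;> simp [H', ht, hHo]
  have hH'W : ∀ t, closure (H' t) ⊆ W t := fun t => by
    by_cases ht : t ∈ J₀
    · simpa [H', ht, G] using hHG (some ⟨t, ht⟩)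
    · simp [H', ht]
  obtain ⟨P, Q, hPo, hQo, hPW, hQH, hPQ, hcov⟩ := h.exists_finset J₀ hcard W
    (fun t => (closure (H' t))ᶜ) hW (fun t => isClosed_closure.isOpen_compl)
    (fun t _ x => by
      by_cases hx : x ∈ closure (H' t)
      · exact Or.inl (hH'W t hx)
      · exact Or.inr hx)
  have hEc : ∀ t, IsOpen (W t \ E) := fun t => (hW t).sdiff hE
  refine ⟨fun t => (if t ∈ J₀ then P t ∪ H' t else W t ∩ ⋃ j ∈ J₀, Q j) ∪ W t \ E, fun t => ?_,
    fun t => ?_, fun x hx => ?_, fun x hx t ht => Or.inr ⟨ht, hx⟩, fun x hx => ?_⟩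
  · refine IsOpen.union ?_ (hEc t)
    split_ifs
    · exact (hPo t).union (hH'o t)
    · exact (hW t).inter (isOpen_biUnion fun j _ => hQo j)
  · refine union_subset ?_ sdiff_subset
    split_ifs
    · exact union_subset (hPW t) (subset_closure.trans (hH'W t))
    · exact inter_subset_left
  · by_cases hxE : x ∈ E
    · by_cases hxJ : ∃ t ∈ J₀, x ∈ P t ∪ H' t
      · obtain ⟨t, ht, hxt⟩ := hxJ
        exact ⟨t, Or.inl (by simpa [ht] using hxt)⟩
      · push Not at hxJ
        obtain ⟨j, hj, hxj⟩ := hcov x hxE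
        have hxQ : x ∈ Q j := hxj.resolve_left fun h => hxJ j hj (Or.inl h)
        obtain ⟨o, ho⟩ := mem_iUnion.1 (hEH hxE)
        cases o with
        | none =>
          have := hHG none (subset_closure ho)
          simp only [G, Option.elim, mem_iUnion] at this
          obtain ⟨t, ht, hxt⟩ := this
          refine ⟨t, Or.inl ?_⟩
          rw [if_neg (show t ∉ J₀ from ht)]
          exact ⟨hxt, mem_biUnion hj hxQ⟩
        | some t =>
          refine absurd (Or.inr ?_) (hxJ t t.2)
          simpa [H'] using ho
    · obtain ⟨t, ht⟩ := hZ x hx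
      exact ⟨t, Or.inr ⟨ht, hxE⟩⟩
  · by_contra! hcon
    have h1 := hcon s hs
    rw [if_neg (Finset.notMem_erase s J)] at h1
    rcases h1 with h1 | h1
    · obtain ⟨j, hj, hxj⟩ := mem_iUnion₂.1 h1.2
      have h2 := hcon j (Finset.mem_of_mem_erase hj)
      rw [if_pos hj] at h2
      rcases h2 with (h2 | h2) | h2
      · exact Set.disjoint_left.1 (hPQ j) h2 hxj
      · exact hQH j hxj (subset_closure h2)
      · exact h2.2 hx
    · exact h1.2 hx

/-- Shrinkings that can be performed over each member of a locally finite family can be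
performed over all of them simultaneously. -/
theorem exists_shrinking_of_locallyFinite {α : Type*} {E : α → Set X} (hlf : LocallyFinite E)
    {Z : Set X} (J : α → Finset ι) (U : ι → Set X) (hU : ∀ t, IsOpen (U t))
    (hZ : ∀ x ∈ Z, ∃ t, x ∈ U t)
    (hstep : ∀ a, ∀ W : ι → Set X, (∀ t, IsOpen (W t)) → (∀ t, W t ⊆ U t) →
      (∀ x ∈ Z, ∃ t, x ∈ W t) →
      ∃ W' : ι → Set X, (∀ t, IsOpen (W' t)) ∧ (∀ t, W' t ⊆ W t) ∧ (∀ x ∈ Z, ∃ t, x ∈ W' t) ∧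
        (∀ x ∉ E a, ∀ t, x ∈ W t → x ∈ W' t) ∧ ∀ x ∈ E a, ∃ t ∈ J a, x ∉ W' t) :
    ∃ W : ι → Set X, (∀ t, IsOpen (W t)) ∧ (∀ t, W t ⊆ U t) ∧ (∀ x ∈ Z, ∃ t, x ∈ W t) ∧
      ∀ a, ∀ x ∈ E a, ∃ t ∈ J a, x ∉ W t := by
  classical
  let T := {p : Set α × (ι → Set X) // (∀ t, IsOpen (p.2 t)) ∧ (∀ t, p.2 t ⊆ U t) ∧
    (∀ x ∈ Z, ∃ t, x ∈ p.2 t) ∧ ∀ a ∈ p.1, ∀ x ∈ E a, ∃ t ∈ J a, x ∉ p.2 t}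
  let r : T → T → Prop := fun p q => p.1.1 ⊆ q.1.1 ∧ (∀ t, q.1.2 t ⊆ p.1.2 t) ∧
    ∀ x, (∀ a ∈ q.1.1, a ∉ p.1.1 → x ∉ E a) → ∀ t, x ∈ p.1.2 t → x ∈ q.1.2 t
  have hrefl : ∀ p, r p p := fun p => ⟨Subset.rfl, fun t => Subset.rfl, fun x _ t h => h⟩
  have htrans : ∀ {p q s : T}, r p q → r q s → r p s := by
    rintro p q s ⟨h1, h2, h3⟩ ⟨h4, h5, h6⟩
    refine ⟨h1.trans h4, fun t => (h5 t).trans (h2 t), fun x hx t ht => ?_⟩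
    exact h6 x (fun a ha ha' => hx a ha fun h => ha' (h1 h)) t
      (h3 x (fun a ha ha' => hx a (h4 ha) ha') t ht)
  obtain ⟨⟨⟨S, W⟩, hWo, hWU, hWZ, hWJ⟩, hmax⟩ := exists_maximal_of_chains_bounded (r := r)
    (fun c hc => by
      rcases c.eq_empty_or_nonempty with rfl | ⟨p₀, hp₀⟩
      · exact ⟨⟨(∅, U), hU, fun _ => Subset.rfl, hZ, by simp⟩, by simp⟩
      have htot : ∀ p ∈ c, ∀ q ∈ c, r p q ∨ r q p := fun p hp q hq => by
        by_cases hpq : p = q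
        · exact Or.inl (hpq ▸ hrefl p)
        · exact hc hp hq hpq
      have hfin : ∀ F : Set α, F.Finite → ∃ p ∈ c, ∀ q ∈ c, ∀ a ∈ F, a ∈ q.1.1 → a ∈ p.1.1 := by
        intro F hF
        induction F, hF using Set.Finite.induction_on with
        | empty => exact ⟨p₀, hp₀, by simp⟩
        | @insert a F _ _ ih =>
          obtain ⟨p, hp, hpF⟩ := ih
          by_cases ha : ∃ q ∈ c, a ∈ q.1.1
          · obtain ⟨q, hq, haq⟩ := ha
            rcases htot p hp q hq with h | h
            · refine ⟨q, hq, fun q' hq' b hb hbq => ?_⟩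
              rcases hb with rfl | hb
              · exact haq
              · exact h.1 (hpF q' hq' b hb hbq)
            · refine ⟨p, hp, fun q' hq' b hb hbq => ?_⟩
              rcases hb with rfl | hb
              · exact h.1 haq
              · exact hpF q' hq' b hb hbq
          · push Not at ha
            refine ⟨p, hp, fun q' hq' b hb hbq => ?_⟩
            rcases hb with rfl | hb
            · exact absurd hbq (ha q' hq')
            · exact hpF q' hq' b hb hbq
      have hloc : ∀ x, ∃ O ∈ 𝓝 x, ∃ p ∈ c, ∀ y ∈ O, ∀ t, y ∈ p.1.2 t →
          ∀ q ∈ c, y ∈ q.1.2 t := by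
        intro x
        obtain ⟨O, hO, hOf⟩ := hlf x
        obtain ⟨p, hp, hpF⟩ := hfin _ hOf
        refine ⟨O, hO, p, hp, fun y hy t hyt q hq => ?_⟩
        rcases htot p hp q hq with h | h
        · exact h.2.2 y (fun a ha ha' hya => ha' (hpF q hq a ⟨y, hya, hy⟩ ha)) t hyt
        · exact h.2.1 t hyt
      refine ⟨⟨(⋃ p ∈ c, p.1.1, fun t => ⋂ p ∈ c, p.1.2 t), fun t => ?_, fun t => ?_,
        fun x hx => ?_, fun a ha x hx => ?_⟩, fun p hp => ⟨?_, fun t => ?_, fun x hx t ht => ?_⟩⟩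
      · rw [isOpen_iff_mem_nhds]
        intro x hx
        obtain ⟨O, hO, p, hp, hOp⟩ := hloc x
        filter_upwards [hO, (p.2.1 t).mem_nhds (mem_iInter₂.1 hx p hp)] with y hy hyt
        exact mem_iInter₂.2 (hOp y hy t hyt)
      · exact (biInter_subset_of_mem hp₀).trans (p₀.2.2.1 t)
      · obtain ⟨O, hO, p, hp, hOp⟩ := hloc x
        obtain ⟨t, ht⟩ := p.2.2.2.1 x hx
        exact ⟨t, mem_iInter₂.2 (hOp x (mem_of_mem_nhds hO) t ht)⟩
      · obtain ⟨p, hp, hap⟩ := mem_iUnion₂.1 ha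
        obtain ⟨t, ht, hxt⟩ := p.2.2.2.2 a hap x hx
        exact ⟨t, ht, fun h => hxt (mem_iInter₂.1 h p hp)⟩
      · exact subset_biUnion_of_mem (u := fun p : T => p.1.1) hp
      · exact biInter_subset_of_mem (t := fun p : T => p.1.2 t) hp
      · refine mem_iInter₂.2 fun q hq => ?_
        rcases htot p hp q hq with h | h
        · exact h.2.2 x (fun a ha ha' => hx a (mem_biUnion hq ha) ha') t ht
        · exact h.2.1 t ht)
    htrans
  refine ⟨W, hWo, hWU, hWZ, fun a => hWJ a ?_⟩
  by_contra ha
  obtain ⟨W', hWo', hWW', hWZ', hoff, hgood⟩ := hstep a W hWo hWU hWZ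
  have := (hmax ⟨(insert a S, W'), hWo', fun t => (hWW' t).trans (hWU t), hWZ', ?_⟩
    ⟨subset_insert a S, hWW', fun x hx t ht => hoff x (hx a (mem_insert a S) ha) t ht⟩).1
  · exact ha (this (mem_insert a S))
  · rintro b (rfl | hb) x hx
    · exact hgood x hx
    · obtain ⟨t, ht, hxt⟩ := hWJ b hb x hx
      exact ⟨t, ht, fun h => hxt (hWW' t h)⟩

/-- A locally finite sum theorem: the union of a locally finite closed family of sets of
dimension `< n` admits open shrinkings of order at most `n` of locally finite open covers. -/
theorem exists_shrinking_card_le [NormalSpace X] {σ : Type*} {n : ℕ} {F : σ → Set X} {Z : Set X}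
    (hF : ∀ s, IsClosed (F s)) (hlf : LocallyFinite F) (hZ : IsClosed Z) (hZF : Z ⊆ ⋃ s, F s)
    (hdim : ∀ s, PairDimLT n (F s ∩ Z)) (U : ι → Set X) (hU : ∀ t, IsOpen (U t))
    (hUlf : LocallyFinite U) (hUZ : ∀ x ∈ Z, ∃ t, x ∈ U t) :
    ∃ W : ι → Set X, (∀ t, IsOpen (W t)) ∧ (∀ t, W t ⊆ U t) ∧ (∀ x ∈ Z, ∃ t, x ∈ W t) ∧
      ∀ x ∈ Z, ∀ J : Finset ι, (∀ t ∈ J, x ∈ W t) → J.card ≤ n := by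
  classical
  let E : σ × {J : Finset ι // J.card = n + 1} → Set X :=
    fun a => F a.1 ∩ Z ∩ ⋂ t ∈ a.2.1, closure (U t)
  have hEc : ∀ a, IsClosed (E a) := fun a =>
    ((hF a.1).inter hZ).inter (isClosed_biInter fun t _ => isClosed_closure)
  have hElf : LocallyFinite E := by
    intro x
    obtain ⟨O, hO, hOf⟩ := hlf x
    obtain ⟨O', hO', hOf'⟩ := hUlf.closure x
    refine ⟨O ∩ O', Filter.inter_mem hO hO', ?_⟩
    refine (hOf.prod ((Finset.finite_toSet hOf'.toFinset.powerset).preimage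
      (Subtype.val_injective (p := fun J : Finset ι => J.card = n + 1)).injOn)).subset ?_
    rintro ⟨s, J⟩ ⟨y, ⟨⟨hy1, -⟩, hy2⟩, hy3, hy4⟩
    refine ⟨⟨y, hy1, hy3⟩, ?_⟩
    simp only [mem_preimage, Finset.mem_coe, Finset.mem_powerset]
    intro t ht
    rw [Set.Finite.mem_toFinset]
    exact ⟨y, mem_iInter₂.1 hy2 t ht, hy4⟩
  obtain ⟨W, hWo, hWU, hWZ, hWE⟩ := exists_shrinking_of_locallyFinite hElf (fun a => a.2.1) U hU hUZ
    fun a W hWo hWU hWZ => ((hdim a.1).mono_set inter_subset_left).exists_shrinking (hEc a)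
      (fun x hx => hx.1.2) a.2.1 a.2.2 W hWo hWZ
  refine ⟨W, hWo, hWU, hWZ, fun x hx J hJ => ?_⟩
  by_contra! hcard
  obtain ⟨J', hJ', hcard'⟩ := Finset.exists_subset_card_eq (Nat.succ_le_of_lt hcard)
  obtain ⟨s, hs⟩ := mem_iUnion.1 (hZF hx)
  obtain ⟨t, ht, hxt⟩ := hWE (s, ⟨J', hcard'⟩) x
    ⟨⟨hs, hx⟩, mem_iInter₂.2 fun t ht => subset_closure (hWU t (hJ t (hJ' ht)))⟩
  exact hxt (hJ t (hJ' ht))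

/-- A locally finite open cover of order at most `n` decomposes, after refinement, into `n`
disjoint open families. -/
theorem exists_disjoint_refinement [NormalSpace X] {n : ℕ} {Z : Set X} (hZ : IsClosed Z)
    (W : ι → Set X) (hW : ∀ t, IsOpen (W t)) (hlf : LocallyFinite W)
    (hWZ : ∀ x ∈ Z, ∃ t, x ∈ W t)
    (hcard : ∀ x ∈ Z, ∀ J : Finset ι, (∀ t ∈ J, x ∈ W t) → J.card ≤ n) :
    ∃ V : Finset ι → Set X, (∀ J, IsOpen (V J)) ∧ (∀ J, ∀ t ∈ J, V J ⊆ W t) ∧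
      (∀ J J', J.card = J'.card → J ≠ J' → Disjoint (V J) (V J')) ∧
      ∀ x ∈ Z, ∃ J : Finset ι, J.Nonempty ∧ J.card ≤ n ∧ x ∈ V J := by
  classical
  obtain ⟨p, hp⟩ := PartitionOfUnity.exists_isSubordinate_of_locallyFinite hZ W hW hlf
    fun x hx => mem_iUnion.2 (hWZ x hx)
  have hpW : ∀ i x, p i x ≠ 0 → x ∈ W i := fun i x hx => hp i (subset_tsupport _ hx)
  refine ⟨fun J => {x | (∀ i ∈ J, 0 < p i x) ∧ ∀ i ∈ J, ∀ j ∉ J, p j x < p i x}, fun J => ?_,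
    fun J t ht x hx => hpW t x (hx.1 t ht).ne', fun J J' hJJ' hne => ?_, fun x hx => ?_⟩
  · rw [isOpen_iff_mem_nhds]
    rintro x ⟨hx1, hx2⟩
    obtain ⟨I, hI⟩ := p.locallyFinite.exists_finset_support x
    have h1 : ∀ᶠ y in 𝓝 x, ∀ i ∈ J, 0 < p i y := (Filter.eventually_all_finset J).2 fun i hi =>
      (p i).continuous.continuousAt.eventually (lt_mem_nhds (hx1 i hi))
    have h2 : ∀ᶠ y in 𝓝 x, ∀ i ∈ J, ∀ j ∈ I \ J, p j y < p i y :=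
      (Filter.eventually_all_finset J).2 fun i hi => (Filter.eventually_all_finset _).2
        fun j hj => (p j).continuous.continuousAt.eventually_lt (p i).continuous.continuousAt
          (hx2 i hi j (Finset.mem_sdiff.1 hj).2)
    filter_upwards [h1, h2, hI] with y hy1 hy2 hy3
    refine ⟨hy1, fun i hi j hj => ?_⟩
    by_cases hjI : j ∈ I
    · exact hy2 i hi j (Finset.mem_sdiff.2 ⟨hjI, hj⟩)
    · have : p j y = 0 := by
        by_contra hne
        exact hjI (hy3 hne)
      rw [this]
      exact hy1 i hi
  · rw [Set.disjoint_left]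
    rintro x ⟨-, hx⟩ ⟨-, hx'⟩
    obtain ⟨i, hi, hi'⟩ : ∃ i ∈ J, i ∉ J' := by
      by_contra! h
      exact hne (Finset.eq_of_subset_of_card_le h hJJ'.ge)
    obtain ⟨j, hj, hj'⟩ : ∃ j ∈ J', j ∉ J := by
      by_contra! h
      exact hne (Finset.eq_of_subset_of_card_le h hJJ'.le).symm
    exact lt_asymm (hx i hi j hj') (hx' j hj i hi')
  · refine ⟨p.finsupport x, ?_, hcard x hx _ fun t ht => hpW t x ((p.mem_finsupport x).1 ht), ?_⟩
    · by_contra hne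
      have := p.sum_finsupport hx
      rw [Finset.not_nonempty_iff_eq_empty.1 hne] at this
      simp at this
    · have hpos : ∀ i ∈ p.finsupport x, 0 < p i x := fun i hi =>
        lt_of_le_of_ne (p.nonneg i x) (Ne.symm ((p.mem_finsupport x).1 hi))
      refine ⟨hpos, fun i hi j hj => ?_⟩
      have : p j x = 0 := by
        by_contra hne
        exact hj ((p.mem_finsupport x).2 hne)
      rw [this]
      exact hpos i hi

/-- A set with a locally finite closed cover by sets of dimension `< n` is covered by disjoint
open refinements of any `n` consecutive open covers. -/
theorem disjointlyCovers_of_pairDimLT [NormalSpace X] [ParacompactSpace X] {σ : Type*} {n : ℕ}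
    {F : σ → Set X} {Z : Set X} (hF : ∀ s, IsClosed (F s)) (hlf : LocallyFinite F)
    (hZ : IsClosed Z) (hZF : Z ⊆ ⋃ s, F s) (hdim : ∀ s, PairDimLT n (F s ∩ Z))
    (U : ℕ → ι → Set X) (hU : ∀ k i, IsOpen (U k i)) (hUc : ∀ k x, ∃ i, x ∈ U k i) (m : ℕ) :
    DisjointlyCovers U m (m + n) Z := by
  classical
  rcases isEmpty_or_nonempty X with hE | ⟨⟨x₀⟩⟩
  · exact ⟨fun _ _ => ∅, by simp, by simp, by simp, fun x => hE.elim x⟩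
  choose c hc using hUc
  obtain ⟨G, hGo, hGc, hGlf, hGU⟩ := precise_refinement
    (fun x : X => ⋂ k ∈ Finset.range (m + n), U k (c k x))
    (fun x => isOpen_biInter_finset fun k _ => hU k _)
    (eq_univ_of_forall fun x => mem_iUnion.2 ⟨x, mem_iInter₂.2 fun k _ => hc k x⟩)
  obtain ⟨W, hWo, hWG, hWZ, hcard⟩ := exists_shrinking_card_le hF hlf hZ hZF hdim G hGo hGlf
    fun x _ => mem_iUnion.1 (hGc ▸ mem_univ x)
  obtain ⟨V, hVo, hVW, hVd, hVZ⟩ := exists_disjoint_refinement hZ W hWo (hGlf.subset hWG) hWZ hcard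
  let s : Finset X → X := fun J => if h : J.Nonempty then h.choose else x₀
  have hs : ∀ J : Finset X, J.Nonempty → s J ∈ J := fun J hJ => by
    simpa [s, hJ] using hJ.choose_spec
  refine ⟨fun k i => ⋃ J ∈ {J : Finset X | J.Nonempty ∧ J.card + m = k + 1 ∧ k < m + n ∧
    c k (s J) = i}, V J, fun k i => isOpen_biUnion fun J _ => hVo J, fun k i => ?_,
    fun k i j hij => ?_, fun x hx => ?_⟩
  · refine iUnion₂_subset ?_
    rintro J ⟨hJ, -, hk, rfl⟩ x hx
    exact mem_iInter₂.1 (hGU _ (hWG _ (hVW J _ (hs J hJ) hx))) k (Finset.mem_range.2 hk)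
  · rw [Set.disjoint_left]
    intro x hx hx'
    obtain ⟨J, ⟨-, h1, -, h2⟩, hxJ⟩ := mem_iUnion₂.1 hx
    obtain ⟨J', ⟨-, h1', -, h2'⟩, hxJ'⟩ := mem_iUnion₂.1 hx'
    refine Set.disjoint_left.1 (hVd J J' (by omega) ?_) hxJ hxJ'
    rintro rfl
    exact hij (h2.symm.trans h2')
  · obtain ⟨J, hJ, hJn, hxJ⟩ := hVZ x hx
    have := hJ.card_pos
    exact ⟨m + J.card - 1, by omega, by omega, c (m + J.card - 1) (s J),
      mem_iUnion₂.2 ⟨J, ⟨hJ, by omega, by omega, rfl⟩, hxJ⟩⟩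

end OrderReduction

section ArbitraryCovers

variable {X ι : Type*} [TopologicalSpace X]

/-- In a finite C-space, off finitely many members of a locally finite open cover, the dimension
is bounded. -/
theorem IsFiniteCSpace.exists_finset_pairDimLT [NormalSpace X] (hX : IsFiniteCSpace X)
    {G F : ι → Set X} (hG : ∀ s, IsOpen (G s)) (hF : ∀ s, IsClosed (F s)) (hlf : LocallyFinite F)
    (hFG : ∀ s, F s ⊆ G s) :
    ∃ (S : Finset ι) (n : ℕ), ∀ s, PairDimLT n (F s ∩ (⋃ t ∈ S, G t)ᶜ) := by
  classical
  by_contra! hcon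
  choose s hs using hcon
  have hs' : ∀ S n, s S n ∉ S := fun S n hmem => hs S n <| by
    convert pairDimLT_empty n using 1
    rw [← Set.disjoint_iff_inter_eq_empty, Set.disjoint_compl_right_iff_subset]
    exact (hFG _).trans (subset_biUnion_of_mem (u := G) hmem)
  let S : ℕ → Finset ι := fun n => Nat.rec ∅ (fun i T => insert (s T i) T) n
  have hS : ∀ i, S (i + 1) = insert (s (S i) i) (S i) := fun i => rfl
  have hmono : Monotone S := monotone_nat_of_le_succ fun i => by
    rw [hS]
    exact Finset.subset_insert _ _
  have hmem : ∀ j i, j < i → s (S j) j ∈ S i := fun j i hji => hmono hji (by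
    rw [hS]
    exact Finset.mem_insert_self _ _)
  have hne : ∀ j i, j < i → s (S j) j ≠ s (S i) i := fun j i hji h =>
    hs' (S i) i (h ▸ hmem j i hji)
  have hinj : Injective fun i => s (S i) i := by
    intro i j h
    rcases lt_trichotomy i j with h' | h' | h'
    · exact absurd h (hne i j h')
    · exact h'
    · exact absurd h.symm (hne j i h')
  have hd : ∀ j i, j < i → Disjoint (F (s (S j) j) ∩ (⋃ t ∈ S j, G t)ᶜ)
      (F (s (S i) i) ∩ (⋃ t ∈ S i, G t)ᶜ) := fun j i hji => by
    rw [Set.disjoint_left]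
    rintro x ⟨hx, -⟩ ⟨-, hx'⟩
    exact hx' (mem_biUnion (hmem j i hji) (hFG _ hx))
  obtain ⟨i, hi⟩ := hX.exists_pairDimLT (A := fun i => F (s (S i) i) ∩ (⋃ t ∈ S i, G t)ᶜ)
    (fun i => (hF _).inter (isOpen_biUnion fun t _ => hG t).isClosed_compl)
    ((hlf.comp_injective hinj).subset fun i => inter_subset_left)
    (fun i j hij => by
      rcases lt_or_gt_of_ne hij with h | h
      · exact hd i j h
      · exact (hd j i h).symm)
  exact hs _ _ hi

/-- In a paracompact Hausdorff finite C-space the finite C-property holds for arbitrary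
open covers. -/
theorem IsFiniteCSpace.disjointlyCovers_of_paracompact [T2Space X] [ParacompactSpace X]
    (hX : IsFiniteCSpace X) (U : ℕ → ι → Set X) (hU : ∀ k i, IsOpen (U k i))
    (hUc : ∀ k x, ∃ i, x ∈ U k i) : ∃ n, DisjointlyCovers U 0 n univ := by
  classical
  choose G hGo hGc hGlf hGU using fun k => precise_refinement (U k) (hU k)
    (eq_univ_of_forall fun x => mem_iUnion.2 (hUc k x))
  choose H hHc hHo hHG using fun k => exists_iUnion_eq_closure_subset (hGo k)
    (hGlf k).point_finite (hGc k)
  choose F hFc hFcl hFH using fun k => exists_iUnion_eq_closed_subset (hHo k)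
    (((hGlf k).subset fun i => subset_closure.trans (hHG k i)).point_finite) (hHc k)
  have hHlf : ∀ k, LocallyFinite (H k) := fun k =>
    (hGlf k).subset fun i => subset_closure.trans (hHG k i)
  have hFlf : ∀ k, LocallyFinite (F k) := fun k => (hHlf k).subset (hFH k)
  choose S n hSn using fun k => hX.exists_finset_pairDimLT (hHo k) (hFcl k) (hFlf k) (hFH k)
  obtain ⟨N, D, hDo, hDs, hDd, hDc⟩ := hX.disjointlyCovers
    (fun k (o : Option ι) => o.elim (⋃ t ∈ S k, closure (H k t))ᶜ
      fun s => if s ∈ S k then G k s else ∅)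
    (fun k o => by
      cases o with
      | none =>
        exact ((S k).finite_toSet.isClosed_biUnion fun t _ => isClosed_closure).isOpen_compl
      | some s =>
        by_cases hs : s ∈ S k <;> simp [hs, hGo])
    (fun k x => by
      by_cases hx : x ∈ ⋃ t ∈ S k, closure (H k t)
      · obtain ⟨t, ht, hxt⟩ := mem_iUnion₂.1 hx
        exact ⟨some t, by simpa [ht] using hHG k t hxt⟩
      · exact ⟨none, hx⟩)
    (fun k => by
      refine (((S k).finite_toSet.image (G k)).union
        (toFinite {∅, (⋃ t ∈ S k, closure (H k t))ᶜ})).subset ?_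
      rintro _ ⟨_ | s, rfl⟩
      · exact Or.inr (Or.inr rfl)
      · by_cases hs : s ∈ S k
        · exact Or.inl ⟨s, hs, by simp [hs]⟩
        · exact Or.inr (Or.inl (by simp [hs])))
  have hrest : ∀ K, ∃ M, N ≤ M ∧ DisjointlyCovers U N M (⋃ k ∈ Finset.range K, D k none) := by
    intro K
    induction K with
    | zero => exact ⟨N, le_rfl, by simpa using disjointlyCovers_empty U N N⟩
    | succ K ih =>
      obtain ⟨M, hNM, hM⟩ := ih
      refine ⟨M + n K, by omega, (hM.union (Z' := (⋃ t ∈ S K, H K t)ᶜ)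
        (disjointlyCovers_of_pairDimLT (hFcl K) (hFlf K)
          (isOpen_biUnion fun t _ => hHo K t).isClosed_compl (by simp [hFc K]) (hSn K) U hU hUc M)
        hNM (by omega)).mono ?_⟩
      rw [Finset.range_add_one, Finset.set_biUnion_insert, union_comm]
      refine union_subset_union_right _ ((hDs K none).trans (compl_subset_compl.2 ?_))
      exact iUnion₂_mono fun t _ => subset_closure
  obtain ⟨M, hNM, hM⟩ := hrest N
  refine ⟨M, (DisjointlyCovers.union (M := N) (Z := ⋃ k ∈ Finset.range N, ⋃ i, D k (some i))
    ⟨fun k i => D k (some i), fun k i => hDo k _, fun k i => (hDs k (some i)).trans ?_,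
      fun k i j hij => hDd k _ _ (by simpa using hij), fun x hx => ?_⟩ hM (Nat.zero_le N)
      hNM).mono ?_⟩
  · by_cases hi : i ∈ S k
    · simpa [hi] using hGU k i
    · simp [hi]
  · obtain ⟨k, hk, hx⟩ := mem_iUnion₂.1 hx
    exact ⟨k, Nat.zero_le k, Finset.mem_range.1 hk, mem_iUnion.1 hx⟩
  · intro x hx
    obtain ⟨k, -, hk, o, ho⟩ := hDc x hx
    cases o with
    | none => exact Or.inr (mem_biUnion (Finset.mem_coe.2 (Finset.mem_range.2 hk)) ho)
    | some i =>
      exact Or.inl (mem_biUnion (Finset.mem_coe.2 (Finset.mem_range.2 hk)) (mem_iUnion.2 ⟨i, ho⟩))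

end ArbitraryCovers

section Simplices

variable {A : Type*}

/-- The geometric simplex spanned by a finite set `L` of vertices, inside `A → ℝ`. -/
def vertexSimplex (L : Finset A) : Set (A → ℝ) :=
  {p | (∀ a, 0 ≤ p a) ∧ (∀ a ∉ L, p a = 0) ∧ ∑ a ∈ L, p a = 1}

theorem vertexSimplex_mono {L M : Finset A} (h : L ⊆ M) : vertexSimplex L ⊆ vertexSimplex M :=
  fun p hp => ⟨hp.1, fun a ha => hp.2.1 a fun h' => ha (h h'), by
    rw [← hp.2.2]
    exact (Finset.sum_subset h fun a _ ha => hp.2.1 a ha).symm⟩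

theorem support_subset_of_mem_vertexSimplex {L : Finset A} {p : A → ℝ}
    (hp : p ∈ vertexSimplex L) : support p ⊆ L := fun a ha => by
  by_contra h
  exact ha (hp.2.1 a h)

theorem mem_vertexSimplex_erase [DecidableEq A] {L : Finset A} {p : A → ℝ}
    (hp : p ∈ vertexSimplex L) {a : A} (ha : p a = 0) : p ∈ vertexSimplex (L.erase a) :=
  ⟨hp.1, fun b hb => by
    by_cases hba : b = a
    · rw [hba, ha]
    · exact hp.2.1 b fun h => hb (Finset.mem_erase.2 ⟨hba, h⟩), by
    rw [← hp.2.2]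
    exact Finset.sum_erase L ha⟩

theorem support_eq_of_mem_vertexSimplex {L : Finset A} {p : A → ℝ} (hp : p ∈ vertexSimplex L)
    (h : ∀ a ∈ L, p a ≠ 0) : support p = L :=
  (support_subset_of_mem_vertexSimplex hp).antisymm h

theorem isClosed_vertexSimplex (L : Finset A) : IsClosed (vertexSimplex L) := by
  have h : vertexSimplex L = (⋂ a, {p : A → ℝ | 0 ≤ p a}) ∩ ((⋂ a ∈ {a | a ∉ L}, {p | p a = 0}) ∩
      {p | ∑ a ∈ L, p a = 1}) := by
    ext p
    simp [vertexSimplex]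
  rw [h]
  refine (isClosed_iInter fun a => isClosed_le continuous_const (continuous_apply a)).inter
    (IsClosed.inter (isClosed_biInter fun a _ => isClosed_eq (continuous_apply a)
      continuous_const) (isClosed_eq (by fun_prop) continuous_const))

theorem isCompact_vertexSimplex (L : Finset A) : IsCompact (vertexSimplex L) := by
  refine (isCompact_univ_pi fun _ : A => isCompact_Icc (a := (0 : ℝ)) (b := 1)).of_isClosed_subset
    (isClosed_vertexSimplex L) fun p hp a _ => ⟨hp.1 a, ?_⟩
  by_cases ha : a ∈ L
  · rw [← hp.2.2]
    exact Finset.single_le_sum (fun b _ => hp.1 b) ha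
  · rw [hp.2.1 a ha]
    exact zero_le_one

/-- The corner simplex in Euclidean space. -/
def cornerSimplex (n : ℕ) : Set (EuclideanSpace ℝ (Fin n)) :=
  {q | (∀ i, 0 ≤ q i) ∧ ∑ i, q i ≤ 1}

theorem isClosed_cornerSimplex (n : ℕ) : IsClosed (cornerSimplex n) := by
  have h : cornerSimplex n = (⋂ i, {q | 0 ≤ q i}) ∩ {q | ∑ i, q i ≤ 1} := by
    ext p
    simp [cornerSimplex]
  rw [h]
  exact (isClosed_iInter fun a => isClosed_le continuous_const (by fun_prop)).inter
    (isClosed_le (by fun_prop) continuous_const)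

theorem convex_cornerSimplex (n : ℕ) : Convex ℝ (cornerSimplex n) := by
  intro x hx y hy a b ha hb hab
  refine ⟨fun i => ?_, ?_⟩
  · have := mul_nonneg ha (hx.1 i)
    have := mul_nonneg hb (hy.1 i)
    simp only [PiLp.add_apply, PiLp.smul_apply, smul_eq_mul]
    linarith
  · simp only [PiLp.add_apply, PiLp.smul_apply, smul_eq_mul, Finset.sum_add_distrib,
      ← Finset.mul_sum]
    have := mul_le_mul_of_nonneg_left hx.2 ha
    have := mul_le_mul_of_nonneg_left hy.2 hb
    linarith

theorem isBounded_cornerSimplex (n : ℕ) : Bornology.IsBounded (cornerSimplex n) := by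
  refine (Metric.isBounded_closedBall (x := (0 : EuclideanSpace ℝ (Fin n))) (r := 1)).subset ?_
  intro q hq
  rw [mem_closedBall_zero_iff, EuclideanSpace.norm_eq, Real.sqrt_le_one]
  refine le_trans (Finset.sum_le_sum fun i _ => ?_) hq.2
  have h1 : q i ≤ 1 := (Finset.single_le_sum (fun j _ => hq.1 j) (Finset.mem_univ i)).trans hq.2
  rw [Real.norm_of_nonneg (hq.1 i)]
  nlinarith [hq.1 i]

theorem mem_interior_cornerSimplex_iff {n : ℕ} {q : EuclideanSpace ℝ (Fin (n + 1))} :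
    q ∈ interior (cornerSimplex (n + 1)) ↔ (∀ i, 0 < q i) ∧ ∑ i, q i < 1 := by
  constructor
  · intro hq
    have hline : ∀ v : EuclideanSpace ℝ (Fin (n + 1)), ∃ ε : ℝ, 0 < ε ∧
        q + ε • v ∈ cornerSimplex (n + 1) := by
      intro v
      have hcont : Continuous fun t : ℝ => q + t • v := by fun_prop
      have := hcont.continuousAt.preimage_mem_nhds (x := 0)
        (t := cornerSimplex (n + 1)) (by simpa using mem_interior_iff_mem_nhds.1 hq)
      obtain ⟨ε, hε, h⟩ := Metric.mem_nhds_iff.1 this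
      refine ⟨ε / 2, by positivity, h ?_⟩
      rw [Metric.mem_ball, Real.dist_eq, sub_zero, abs_of_pos (by positivity)]
      linarith
    refine ⟨fun i => ?_, ?_⟩
    · obtain ⟨ε, hε, h⟩ := hline (EuclideanSpace.single i (-1))
      have := h.1 i
      simp at this
      linarith
    · obtain ⟨ε, hε, h⟩ := hline (EuclideanSpace.single 0 1)
      have := h.2
      simp [Finset.sum_add_distrib] at this
      linarith
  · rintro ⟨h1, h2⟩
    refine mem_interior.2 ⟨{q | (∀ i, 0 < q i) ∧ ∑ i, q i < 1},
      fun p hp => ⟨fun i => (hp.1 i).le, hp.2.le⟩, ?_, h1, h2⟩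
    have h : {q : EuclideanSpace ℝ (Fin (n + 1)) | (∀ i, 0 < q i) ∧ ∑ i, q i < 1} =
        (⋂ i, {q | 0 < q i}) ∩ {q | ∑ i, q i < 1} := by
      ext p
      simp
    rw [h]
    exact (isOpen_iInter_of_finite fun a => isOpen_lt continuous_const (by fun_prop)).inter
      (isOpen_lt (by fun_prop) continuous_const)

theorem nonempty_interior_cornerSimplex (n : ℕ) : (interior (cornerSimplex (n + 1))).Nonempty := by
  refine ⟨WithLp.toLp 2 fun _ => 1 / (n + 2 : ℝ), mem_interior_cornerSimplex_iff.2 ⟨fun i => ?_, ?_⟩⟩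
  · simp only
    positivity
  · simp only [Finset.sum_const, Finset.card_univ, Fintype.card_fin, nsmul_eq_mul]
    rw [mul_one_div, div_lt_one (by positivity)]
    push_cast
    linarith

theorem EmbedIn.subset {Y : Type*} [TopologicalSpace Y] {k : ℕ} {S B : Set Y}
    (h : EmbedIn k S B) : S ⊆ B := by
  intro y hy
  obtain ⟨g, -, hg, hgf⟩ := h (fun _ => y) continuous_const (by
    rintro _ ⟨z, rfl⟩
    exact hy)
  let z : Metric.sphere (0 : EuclideanSpace ℝ (Fin (k + 1))) 1 :=
    ⟨EuclideanSpace.single 0 1, by simp⟩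
  exact hgf z ▸ hg (mem_range_self _)

/-- If `S ↪ₖ B`, maps of the boundary of a `(k+1)`-simplex into `S` extend over the simplex,
with values in `B`. -/
theorem EmbedIn.exists_extension_vertexSimplex {Y : Type*} [TopologicalSpace Y] {k : ℕ}
    {S B : Set Y} (h : EmbedIn k S B) {L : Finset A} (hL : L.card = k + 2) (f : (A → ℝ) → Y)
    (hf : ContinuousOn f {p ∈ vertexSimplex L | ∃ a ∈ L, p a = 0})
    (hfS : MapsTo f {p ∈ vertexSimplex L | ∃ a ∈ L, p a = 0} S) :
    ∃ g : (A → ℝ) → Y, ContinuousOn g (vertexSimplex L) ∧ MapsTo g (vertexSimplex L) B ∧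
      EqOn g f {p ∈ vertexSimplex L | ∃ a ∈ L, p a = 0} := by
  classical
  obtain ⟨a₀, ha₀⟩ : L.Nonempty := by
    rw [← Finset.card_pos]
    omega
  have hcard : (L.erase a₀).card = k + 1 := by
    rw [Finset.card_erase_of_mem ha₀]
    omega
  let e : {a // a ∈ L.erase a₀} ≃ Fin (k + 1) := (L.erase a₀).equivFinOfCardEq hcard
  let toE : (A → ℝ) → EuclideanSpace ℝ (Fin (k + 1)) := fun p => WithLp.toLp 2 fun i => p (e.symm i)
  let ofE : EuclideanSpace ℝ (Fin (k + 1)) → A → ℝ := fun q a =>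
    if a = a₀ then 1 - ∑ i, q i else if ha : a ∈ L.erase a₀ then q (e ⟨a, ha⟩) else 0
  have htoE : Continuous toE := by
    refine (PiLp.continuous_toLp 2 _).comp ?_
    fun_prop
  have hofE : Continuous ofE := by
    refine continuous_pi fun a => ?_
    by_cases h1 : a = a₀
    · simp only [ofE, h1, if_true]
      fun_prop
    · by_cases h2 : a ∈ L.erase a₀
      · simp only [ofE, h1, h2, if_false, dif_pos]
        fun_prop
      · simp only [ofE, h1, h2, if_false, dif_neg, not_false_eq_true]
        fun_prop
  have hsum : ∀ p : A → ℝ, ∑ i, p (e.symm i) = ∑ a ∈ L.erase a₀, p a := fun p => by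
    rw [← Finset.sum_coe_sort (L.erase a₀)]
    exact Equiv.sum_comp e.symm fun a : {a // a ∈ L.erase a₀} => p a
  have hsum' : ∀ p ∈ vertexSimplex L, ∑ i, p (e.symm i) = 1 - p a₀ := fun p hp => by
    rw [hsum, ← hp.2.2, ← Finset.add_sum_erase L p ha₀]
    ring
  have hofto : ∀ p ∈ vertexSimplex L, ofE (toE p) = p := fun p hp => by
    funext a
    by_cases h1 : a = a₀
    · simp only [ofE, h1, if_true, toE, hsum' p hp]
      ring
    · by_cases h2 : a ∈ L.erase a₀
      · simp only [ofE, h1, h2, if_false, dif_pos, toE]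
        simp
      · simp only [ofE, h1, h2, if_false, dif_neg, not_false_eq_true]
        exact (hp.2.1 a fun h => h2 (Finset.mem_erase.2 ⟨h1, h⟩)).symm
  have htoT : ∀ p ∈ vertexSimplex L, toE p ∈ cornerSimplex (k + 1) := fun p hp => by
    refine ⟨fun i => hp.1 _, ?_⟩
    simp only [toE, hsum' p hp]
    linarith [hp.1 a₀]
  have hofa₀ : ∀ q, ofE q a₀ = 1 - ∑ i, q i := fun q => by simp [ofE]
  have hofe : ∀ q i, ofE q (e.symm i) = q i := fun q i => by
    have h1 : ((e.symm i : {a // a ∈ L.erase a₀}) : A) ≠ a₀ := Finset.ne_of_mem_erase (e.symm i).2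
    have h2 : ((e.symm i : {a // a ∈ L.erase a₀}) : A) ∈ L.erase a₀ := (e.symm i).2
    simp only [ofE, h1, if_false, dif_pos h2]
    simp
  have hofT : ∀ q ∈ cornerSimplex (k + 1), ofE q ∈ vertexSimplex L := fun q hq => by
    refine ⟨fun a => ?_, fun a ha => ?_, ?_⟩
    · by_cases h1 : a = a₀
      · rw [h1, hofa₀]
        linarith [hq.2]
      · by_cases h2 : a ∈ L.erase a₀
        · simpa only [ofE, h1, h2, if_false, dif_pos] using hq.1 _
        · simp only [ofE, h1, h2, if_false, dif_neg, not_false_eq_true, le_refl]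
    · have h1 : a ≠ a₀ := fun h => ha (h ▸ ha₀)
      have h2 : a ∉ L.erase a₀ := fun h => ha (Finset.mem_of_mem_erase h)
      simp only [ofE, h1, h2, if_false, dif_neg, not_false_eq_true]
    · rw [← Finset.add_sum_erase L _ ha₀, ← hsum, hofa₀]
      simp only [hofe]
      ring
  obtain ⟨Φ, hΦi, hΦc, hΦf⟩ := exists_homeomorph_image_interior_closure_frontier_eq_unitBall
    (convex_cornerSimplex (k + 1)) (nonempty_interior_cornerSimplex k)
    (isBounded_cornerSimplex (k + 1))
  rw [(isClosed_cornerSimplex _).closure_eq] at hΦc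
  have hfr : ∀ q, q ∈ frontier (cornerSimplex (k + 1)) ↔ q ∈ cornerSimplex (k + 1) ∧
      q ∉ interior (cornerSimplex (k + 1)) := fun q => by
    rw [(isClosed_cornerSimplex _).frontier_eq]
    exact Iff.rfl
  have hbd : ∀ z : Metric.sphere (0 : EuclideanSpace ℝ (Fin (k + 1))) 1,
      ofE (Φ.symm z) ∈ {p ∈ vertexSimplex L | ∃ a ∈ L, p a = 0} := by
    intro z
    have hz : (z : EuclideanSpace ℝ (Fin (k + 1))) ∈ Φ '' frontier (cornerSimplex (k + 1)) := by
      rw [hΦf]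
      exact z.2
    obtain ⟨q, hq, hqz⟩ := hz
    rw [← hqz, Homeomorph.symm_apply_apply]
    obtain ⟨hqT, hqi⟩ := (hfr q).1 hq
    refine ⟨hofT q hqT, ?_⟩
    by_contra! hcon
    refine hqi (mem_interior_cornerSimplex_iff.2 ⟨fun i => ?_, ?_⟩)
    · have := hcon (e.symm i) (Finset.mem_of_mem_erase (e.symm i).2)
      rw [hofe] at this
      exact lt_of_le_of_ne (hqT.1 i) this.symm
    · have := hcon a₀ ha₀
      rw [hofa₀] at this
      exact lt_of_le_of_ne hqT.2 fun h => this (by rw [h, sub_self])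
  obtain ⟨g, hgc, hgB, hgf⟩ := h (fun z => f (ofE (Φ.symm z)))
    (hf.comp_continuous (hofE.comp (Φ.symm.continuous.comp continuous_subtype_val)) hbd)
    (by
      rintro _ ⟨z, rfl⟩
      exact hfS (hbd z))
  have hball : ∀ p ∈ vertexSimplex L, Φ (toE p) ∈ Metric.closedBall 0 1 := fun p hp => by
    rw [← hΦc]
    exact mem_image_of_mem _ (htoT p hp)
  obtain ⟨y₀⟩ : Nonempty Y := ⟨g ⟨0, by simp⟩⟩
  refine ⟨fun p => if hp : p ∈ vertexSimplex L then g ⟨Φ (toE p), hball p hp⟩ else y₀, ?_, ?_, ?_⟩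
  · rw [continuousOn_iff_continuous_domRestrict]
    have : (vertexSimplex L).domRestrict (fun p => if hp : p ∈ vertexSimplex L then
        g ⟨Φ (toE p), hball p hp⟩ else y₀) =
        fun p : vertexSimplex L => g ⟨Φ (toE p), hball p p.2⟩ := by
      funext p
      simp
    rw [this]
    exact hgc.comp (Continuous.subtype_mk
      (Φ.continuous.comp (htoE.comp continuous_subtype_val)) _)
  · intro p hp
    simp only [hp, dif_pos]
    exact hgB (mem_range_self _)
  · rintro p ⟨hp, a, haL, ha⟩
    simp only [hp, dif_pos]
    have hsph : Φ (toE p) ∈ Metric.sphere 0 1 := by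
      rw [← hΦf]
      refine mem_image_of_mem _ ((hfr _).2 ⟨htoT p hp, fun hi => ?_⟩)
      obtain ⟨h1, h2⟩ := mem_interior_cornerSimplex_iff.1 hi
      by_cases haa : a = a₀
      · simp only [toE, hsum' p hp, ← haa, ha] at h2
        linarith
      · have := h1 (e ⟨a, Finset.mem_erase.2 ⟨haa, haL⟩⟩)
        simp [toE, ha] at this
    have := hgf ⟨_, hsph⟩
    simp only [Homeomorph.symm_apply_apply, hofto p hp] at this
    exact this

end Simplices

section Skeleton

variable {A Y : Type*} [TopologicalSpace Y]

theorem boundary_vertexSimplex_eq [DecidableEq A] (L : Finset A) :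
    {p ∈ vertexSimplex L | ∃ a ∈ L, p a = 0} = ⋃ a : L, vertexSimplex (L.erase a) := by
  ext p
  simp only [mem_ofPred_eq, mem_iUnion, Subtype.exists]
  constructor
  · rintro ⟨hp, a, haL, ha⟩
    exact ⟨a, haL, mem_vertexSimplex_erase hp ha⟩
  · rintro ⟨a, haL, hp⟩
    exact ⟨vertexSimplex_mono (Finset.erase_subset a L) hp, a, haL,
      hp.2.1 a (Finset.notMem_erase a L)⟩

/-- A map which is already defined on the faces outside a family `new` of simplices extends,
skeleton by skeleton, over the simplices of that family. -/
theorem exists_skeleton_extension {new : Set (Finset A)} {ψ : Finset A → ℕ → Set Y}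
    (hL : ∀ L ∈ new, L.Nonempty) (hne : ∀ L ∈ new, (ψ L 0).Nonempty)
    (hψ : ∀ L ∈ new, ∀ k, EmbedIn k (ψ L k) (ψ L (k + 1))) {Γ : (A → ℝ) → Y}
    (hface : ∀ L ∈ new, ∀ M ⊂ L, M.Nonempty → (M ∈ new ∧ ψ M = ψ L) ∨
      ((∀ M' ⊆ M, M' ∉ new) ∧ ContinuousOn Γ (vertexSimplex M) ∧
        MapsTo Γ (vertexSimplex M) (ψ L (M.card - 1)))) (N : ℕ) :
    ∃ Γ' : (A → ℝ) → Y, (∀ p, (∀ L ∈ new, (L : Set A) ≠ support p) → Γ' p = Γ p) ∧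
      ∀ L ∈ new, L.card ≤ N → ContinuousOn Γ' (vertexSimplex L) ∧
        MapsTo Γ' (vertexSimplex L) (ψ L (L.card - 1)) := by
  classical
  induction N with
  | zero =>
    refine ⟨Γ, fun _ _ => rfl, fun L hLn hc => ?_⟩
    have := (hL L hLn).card_pos
    omega
  | succ j ih =>
    obtain ⟨Δ, hΔ, hΔn⟩ := ih
    have key : ∀ L, ∃ g : (A → ℝ) → Y, L ∈ new → L.card = j + 1 →
        ContinuousOn g (vertexSimplex L) ∧ MapsTo g (vertexSimplex L) (ψ L j) ∧
          EqOn g Δ {p ∈ vertexSimplex L | ∃ a ∈ L, p a = 0} := by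
      intro L
      by_cases hLn : L ∈ new ∧ L.card = j + 1
      swap
      · exact ⟨Γ, fun h1 h2 => absurd ⟨h1, h2⟩ hLn⟩
      obtain ⟨hLn, hc⟩ := hLn
      rcases j with _ | k
      · obtain ⟨y, hy⟩ := hne L hLn
        refine ⟨fun _ => y, fun _ _ => ⟨continuousOn_const, fun _ _ => hy, ?_⟩⟩
        rintro p ⟨hp, a, haL, ha⟩
        obtain ⟨b, rfl⟩ := Finset.card_eq_one.1 hc
        have h1 := hp.2.2
        rw [Finset.mem_singleton] at haL
        rw [Finset.sum_singleton, ← haL, ha] at h1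
        exact absurd h1 zero_ne_one
      · have hb : ∀ a : L, ContinuousOn Δ (vertexSimplex (L.erase a)) ∧
            MapsTo Δ (vertexSimplex (L.erase a)) (ψ L k) := by
          rintro ⟨a, ha⟩
          have hca : (L.erase a).card = k + 1 := by
            rw [Finset.card_erase_of_mem ha]
            omega
          rcases hface L hLn _ (Finset.erase_ssubset ha) (Finset.card_pos.1 (by omega)) with
            ⟨h1, h2⟩ | ⟨h1, h2, h3⟩
          · have := hΔn _ h1 hca.le
            rwa [h2, hca] at this
          · have heq : EqOn Δ Γ (vertexSimplex (L.erase a)) := fun p hp => hΔ p fun M hM hMp =>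
              h1 M (Finset.coe_subset.1 (hMp ▸ support_subset_of_mem_vertexSimplex hp)) hM
            rw [hca] at h3
            exact ⟨h2.congr heq, h3.congr heq.symm⟩
        obtain ⟨g, hg⟩ := (hψ L hLn k).exists_extension_vertexSimplex hc Δ
          (by
            rw [boundary_vertexSimplex_eq]
            exact (locallyFinite_of_finite _).continuousOn_iUnion
              (fun a => isClosed_vertexSimplex _) fun a => (hb a).1)
          (by
            rw [boundary_vertexSimplex_eq]
            exact mapsTo_iUnion.2 fun a => (hb a).2)
        exact ⟨g, fun _ _ => hg⟩
    choose g hg using key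
    let Γ' : (A → ℝ) → Y := fun p =>
      if h : ∃ L ∈ new, L.card = j + 1 ∧ (L : Set A) = support p then g h.choose p else Δ p
    have hneg : ∀ p, (¬ ∃ L ∈ new, L.card = j + 1 ∧ (L : Set A) = support p) → Γ' p = Δ p :=
      fun p h => dif_neg h
    have hpos : ∀ p, ∀ L ∈ new, L.card = j + 1 → (L : Set A) = support p → Γ' p = g L p := by
      intro p L hLn hc hLp
      have h : ∃ L ∈ new, L.card = j + 1 ∧ (L : Set A) = support p := ⟨L, hLn, hc, hLp⟩
      have : h.choose = L := Finset.coe_injective (h.choose_spec.2.2.trans hLp.symm)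
      change dite _ _ _ = _
      rw [dif_pos h, this]
    refine ⟨Γ', fun p hp => ?_, fun L hLn hc => ?_⟩
    · rw [hneg p fun ⟨L, h1, _, h2⟩ => hp L h1 h2, hΔ p hp]
    · rcases Nat.lt_or_ge j L.card with h | h
      · have hc : L.card = j + 1 := by omega
        obtain ⟨h1, h2, h3⟩ := hg L hLn hc
        have heq : EqOn Γ' (g L) (vertexSimplex L) := by
          intro p hp
          by_cases h0 : ∃ a ∈ L, p a = 0
          · rw [h3 ⟨hp, h0⟩]
            refine hneg p ?_
            rintro ⟨M, -, hM, hMp⟩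
            obtain ⟨a, haL, ha⟩ := h0
            have hsub : M ⊆ L :=
              Finset.coe_subset.1 (hMp ▸ support_subset_of_mem_vertexSimplex hp)
            have : a ∈ (M : Set A) := by
              rwa [Finset.eq_of_subset_of_card_le hsub (by omega)]
            rw [hMp] at this
            exact this ha
          · push Not at h0
            exact hpos p L hLn hc (support_eq_of_mem_vertexSimplex hp h0).symm
        rw [hc]
        exact ⟨h1.congr heq, h2.congr heq.symm⟩
      · have heq : EqOn Γ' Δ (vertexSimplex L) := by
          intro p hp
          refine hneg p ?_
          rintro ⟨M, -, hM, hMp⟩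
          have hsub : M ⊆ L :=
            Finset.coe_subset.1 (hMp ▸ support_subset_of_mem_vertexSimplex hp)
          have := Finset.card_le_card hsub
          omega
        exact ⟨(hΔn L hLn h).1.congr heq, (hΔn L hLn h).2.congr heq.symm⟩

end Skeleton

section Stages

variable {X Y : Type*} [TopologicalSpace X] [TopologicalSpace Y]

/-- `L` spans a simplex of the nerve of the first `n` covers, with at most one vertex in each
cover, and `x` lies in the closures of all its vertices. -/
structure IsNerveSimplex (n : ℕ) (U : ℕ → X → Set X) (x : X) (L : Finset (ℕ × X)) : Prop where
  lt : ∀ a ∈ L, a.1 < n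
  injOn : InjOn Prod.fst (L : Set (ℕ × X))
  mem_closure : ∀ a ∈ L, x ∈ closure (U a.1 a.2)

theorem IsNerveSimplex.card_le {n : ℕ} {U : ℕ → X → Set X} {x : X} {L : Finset (ℕ × X)}
    (h : IsNerveSimplex n U x L) : L.card ≤ n := by
  rw [← Finset.card_range n]
  exact Finset.card_le_card_of_injOn Prod.fst (fun a ha => Finset.mem_coe.2
    (Finset.mem_range.2 (h.lt a ha))) h.injOn

theorem IsNerveSimplex.mono {n : ℕ} {U : ℕ → X → Set X} {x : X} {L M : Finset (ℕ × X)}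
    (h : IsNerveSimplex n U x L) (hM : M ⊆ L) : IsNerveSimplex n U x M :=
  ⟨fun a ha => h.lt a (hM ha), h.injOn.mono hM, fun a ha => h.mem_closure a (hM ha)⟩

/-- The first `n` entries of `U` are locally finite open covers and `Γ` maps their nerve
compatibly with the sequence `φ`. -/
structure IsNerveMap (φ : ℕ → X → Set Y) (n : ℕ) (U : ℕ → X → Set X) (Γ : (ℕ × X → ℝ) → Y) :
    Prop where
  isOpen : ∀ k < n, ∀ i, IsOpen (U k i)
  cover : ∀ k < n, ∀ x, ∃ i, x ∈ U k i
  locallyFinite : ∀ k < n, LocallyFinite (U k)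
  continuousOn : ∀ L x, L.Nonempty → IsNerveSimplex n U x L → ContinuousOn Γ (vertexSimplex L)
  mapsTo : ∀ L x, L.Nonempty → IsNerveSimplex n U x L →
    MapsTo Γ (vertexSimplex L) (φ (L.card - 1) x)

theorem finite_isNerveSimplex {n : ℕ} {U : ℕ → X → Set X} (hU : ∀ k < n, LocallyFinite (U k))
    (x : X) : {L | IsNerveSimplex n U x L}.Finite := by
  classical
  have hfin : {a : ℕ × X | a.1 < n ∧ x ∈ closure (U a.1 a.2)}.Finite := by
    have : {a : ℕ × X | a.1 < n ∧ x ∈ closure (U a.1 a.2)} =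
        ⋃ k ∈ {k | k < n}, Prod.mk k '' {i | x ∈ closure (U k i)} := by
      ext ⟨k, i⟩
      simp [and_comm]
    rw [this]
    exact (finite_lt_nat n).biUnion fun k hk => ((hU k hk).closure.point_finite x).image _
  refine hfin.toFinset.powerset.finite_toSet.subset fun L hL => ?_
  rw [Finset.mem_coe, Finset.mem_powerset]
  exact fun a ha => hfin.mem_toFinset.2 ⟨hL.lt a ha, hL.mem_closure a ha⟩

theorem eventually_isNerveSimplex {n : ℕ} {U : ℕ → X → Set X}
    (hU : ∀ k < n, LocallyFinite (U k)) (x : X) :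
    ∀ᶠ x' in 𝓝 x, ∀ L, IsNerveSimplex n U x' L → IsNerveSimplex n U x L := by
  have h : ∀ᶠ x' in 𝓝 x, ∀ k ∈ {k | k < n}, {i | x' ∈ closure (U k i)} ⊆
      {i | x ∈ closure (U k i)} :=
    (Filter.eventually_all_finite (finite_lt_nat n)).2 fun k hk =>
      (hU k hk).closure.eventually_subset (fun _ => isClosed_closure) x
  filter_upwards [h] with x' hx' L hL
  exact ⟨hL.lt, hL.injOn, fun a ha => hx' a.1 (hL.lt a ha) (hL.mem_closure a ha)⟩

theorem IsNerveMap.exists_succ [T2Space X] [ParacompactSpace X] {φ : ℕ → X → Set Y}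
    (hne : ∀ k x, (φ k x).Nonempty) (hllc : ∀ k, LowerLocallyConstant (φ k))
    (hasph : ∀ k x, EmbedIn k (φ k x) (φ (k + 1) x)) {n : ℕ} {U : ℕ → X → Set X}
    {Γ : (ℕ × X → ℝ) → Y} (h : IsNerveMap φ n U Γ) :
    ∃ U' Γ', IsNerveMap φ (n + 1) U' Γ' ∧ ∀ k < n, U' k = U k := by
  classical
  let new : Set (Finset (ℕ × X)) := {L | ∃ x L₀, L = insert (n, x) L₀ ∧ IsNerveSimplex n U x L₀}
  let ψ : Finset (ℕ × X) → ℕ → Set Y := fun L k => ⋂ x ∈ {x | (n, x) ∈ L}, φ k x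
  have hnot : ∀ {x L₀}, IsNerveSimplex n U x L₀ → ∀ z, (n, z) ∉ L₀ := fun hL z hz =>
    lt_irrefl _ (hL.lt _ hz)
  have hψ : ∀ {x L₀}, IsNerveSimplex n U x L₀ →
      ψ (insert (n, x) L₀) = fun k => φ k x := by
    intro x L₀ hL
    have : {z | (n, z) ∈ insert (n, x) L₀} = {x} := by
      ext z
      simp [hnot hL z]
    funext k
    simp only [ψ, this, biInter_singleton]
  have hcard : ∀ {x L₀}, IsNerveSimplex n U x L₀ → (insert (n, x) L₀).card = L₀.card + 1 :=
    fun hL => Finset.card_insert_of_notMem (hnot hL _)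
  have hnotnew : ∀ {x L₀}, IsNerveSimplex n U x L₀ → ∀ M ⊆ L₀, M ∉ new := by
    rintro x L₀ hL M hM ⟨z, M₀, rfl, -⟩
    exact hnot hL z (hM (Finset.mem_insert_self _ _))
  obtain ⟨Γ', hΓ', hΓn⟩ := exists_skeleton_extension (new := new) (ψ := ψ) (Γ := Γ)
    (by
      rintro _ ⟨x, L₀, rfl, -⟩
      exact Finset.insert_nonempty _ _)
    (by
      rintro _ ⟨x, L₀, rfl, hL⟩
      rw [hψ hL]
      exact hne 0 x)
    (by
      rintro _ ⟨x, L₀, rfl, hL⟩ k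
      rw [hψ hL]
      exact hasph k x)
    (by
      rintro _ ⟨x, L₀, rfl, hL⟩ M hM hMne
      by_cases hx : (n, x) ∈ M
      · have hM₀ : IsNerveSimplex n U x (M.erase (n, x)) :=
          hL.mono (Finset.subset_insert_iff.1 hM.1)
        have hMi : insert (n, x) (M.erase (n, x)) = M := Finset.insert_erase hx
        refine Or.inl ⟨⟨x, _, hMi.symm, hM₀⟩, ?_⟩
        rw [hψ hL, ← hMi, hψ hM₀]
      · have hML : M ⊆ L₀ := (Finset.subset_insert_iff_of_notMem hx).1 hM.1
        refine Or.inr ⟨fun M' hM' => hnotnew hL M' (hM'.trans hML),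
          h.continuousOn M x hMne (hL.mono hML), ?_⟩
        rw [hψ hL]
        exact h.mapsTo M x hMne (hL.mono hML)) (n + 1)
  have hΓnew : ∀ {x L₀}, IsNerveSimplex n U x L₀ →
      ContinuousOn Γ' (vertexSimplex (insert (n, x) L₀)) ∧
        MapsTo Γ' (vertexSimplex (insert (n, x) L₀)) (φ L₀.card x) := by
    intro x L₀ hL
    have := hΓn _ ⟨x, L₀, rfl, hL⟩ (by
      rw [hcard hL]
      exact Nat.succ_le_succ hL.card_le)
    rwa [hψ hL, hcard hL] at this
  have hnhds : ∀ x, ∃ O : Set X, IsOpen O ∧ x ∈ O ∧ ∀ x' ∈ O, ∀ L₀, IsNerveSimplex n U x' L₀ →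
      IsNerveSimplex n U x L₀ ∧
        MapsTo Γ' (vertexSimplex (insert (n, x) L₀)) (φ L₀.card x') := by
    intro x
    have h1 : ∀ᶠ x' in 𝓝 x, ∀ L₀ ∈ {L | IsNerveSimplex n U x L},
        MapsTo Γ' (vertexSimplex (insert (n, x) L₀)) (φ L₀.card x') :=
      (Filter.eventually_all_finite (finite_isNerveSimplex h.locallyFinite x)).2 fun L₀ hL => by
        simp only [mapsTo_iff_image_subset]
        exact (hllc _ _ ((isCompact_vertexSimplex _).image_of_continuousOn
          (hΓnew hL).1)).mem_nhds (hΓnew hL).2.image_subset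
    obtain ⟨O, hO, hOo, hxO⟩ := mem_nhds_iff.1
      ((eventually_isNerveSimplex h.locallyFinite x).and h1)
    exact ⟨O, hOo, hxO, fun x' hx' L₀ hL =>
      ⟨(hO hx').1 L₀ hL, (hO hx').2 L₀ ((hO hx').1 L₀ hL)⟩⟩
  choose O hOo hxO hO using hnhds
  obtain ⟨W, hWo, hWc, hWf, hWO⟩ := precise_refinement O hOo
    (iUnion_eq_univ_iff.2 fun x => ⟨x, hxO x⟩)
  obtain ⟨V, hVc, hVo, hVW⟩ := exists_iUnion_eq_closure_subset hWo hWf.point_finite hWc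
  have hU' : ∀ k < n, Function.update U n V k = U k := fun k hk => by
    rw [Function.update_of_ne hk.ne]
  have hold : ∀ {x L}, IsNerveSimplex (n + 1) (Function.update U n V) x L → ∀ M ⊆ L,
      (∀ a ∈ M, a.1 < n) → IsNerveSimplex n U x M := by
    intro x L hL M hM hlt
    refine ⟨hlt, hL.injOn.mono hM, fun a ha => ?_⟩
    have := hL.mem_closure a (hM ha)
    rwa [hU' _ (hlt a ha)] at this
  have hmain : ∀ L x, L.Nonempty → IsNerveSimplex (n + 1) (Function.update U n V) x L →
      ContinuousOn Γ' (vertexSimplex L) ∧ MapsTo Γ' (vertexSimplex L) (φ (L.card - 1) x) := by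
    intro L x hLne hL
    by_cases htop : ∃ z, (n, z) ∈ L
    · obtain ⟨z, hz⟩ := htop
      have hL₀ : IsNerveSimplex n U x (L.erase (n, z)) :=
        hold hL _ (Finset.erase_subset _ _) fun a ha => by
          have h1 := hL.lt a (Finset.mem_of_mem_erase ha)
          have h2 : a.1 ≠ n := fun h' => Finset.ne_of_mem_erase ha
            (hL.injOn (Finset.mem_of_mem_erase ha) hz h')
          omega
      have hxz : x ∈ closure (V z) := by
        have := hL.mem_closure _ hz
        rwa [Function.update_self] at this
      obtain ⟨h1, h2⟩ := hO z x (hWO z (hVW z hxz)) _ hL₀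
      have h3 := (hΓnew h1).1
      rw [Finset.insert_erase hz] at h2 h3
      rw [Finset.card_erase_of_mem hz] at h2
      exact ⟨h3, h2⟩
    · have hL₀ : IsNerveSimplex n U x L := hold hL L subset_rfl fun a ha => by
        have h1 := hL.lt a ha
        have h2 : a.1 ≠ n := fun h' => htop ⟨a.2, h' ▸ ha⟩
        omega
      have heq : EqOn Γ' Γ (vertexSimplex L) := fun p hp => hΓ' p fun M hM hMp =>
        hnotnew hL₀ M
          (Finset.coe_subset.1 (hMp ▸ support_subset_of_mem_vertexSimplex hp)) hM
      exact ⟨(h.continuousOn L x hLne hL₀).congr heq, (h.mapsTo L x hLne hL₀).congr heq.symm⟩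
  refine ⟨Function.update U n V, Γ', ⟨fun k hk => ?_, fun k hk => ?_, fun k hk => ?_,
    fun L x hLne hL => (hmain L x hLne hL).1, fun L x hLne hL => (hmain L x hLne hL).2⟩, hU'⟩
  all_goals
    rcases Nat.lt_succ_iff_lt_or_eq.1 hk with hk | rfl
  · rw [hU' k hk]
    exact h.isOpen k hk
  · rw [Function.update_self]
    exact hVo
  · rw [hU' k hk]
    exact h.cover k hk
  · rw [Function.update_self]
    exact iUnion_eq_univ_iff.1 hVc
  · rw [hU' k hk]
    exact h.locallyFinite k hk
  · rw [Function.update_self]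
    exact hWf.subset fun z => subset_closure.trans (hVW z)

/-- There are locally finite open covers, indexed by the natural numbers, whose finite initial
segments all have nerve maps. -/
theorem exists_forall_isNerveMap [T2Space X] [ParacompactSpace X] [Nonempty Y]
    {φ : ℕ → X → Set Y}
    (hne : ∀ k x, (φ k x).Nonempty) (hllc : ∀ k, LowerLocallyConstant (φ k))
    (hasph : ∀ k x, EmbedIn k (φ k x) (φ (k + 1) x)) :
    ∃ U : ℕ → X → Set X, ∀ n, ∃ Γ, IsNerveMap φ n U Γ := by
  let S : ℕ → Type _ := fun n =>
    {s : (ℕ → X → Set X) × ((ℕ × X → ℝ) → Y) // IsNerveMap φ n s.1 s.2}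
  have hstep : ∀ n (s : S n), ∃ t : S (n + 1), ∀ k < n, t.1.1 k = s.1.1 k := fun n s => by
    obtain ⟨U', Γ', h, hU⟩ := s.2.exists_succ hne hllc hasph
    exact ⟨⟨(U', Γ'), h⟩, hU⟩
  choose next hnext using hstep
  let s₀ : S 0 := ⟨(fun _ _ => univ, fun _ => Classical.arbitrary Y),
    ⟨by simp, by simp, by simp, fun _ _ _ _ => continuousOn_const, fun L x hL h => by
      have h1 := h.card_le
      have h2 := hL.card_pos
      omega⟩⟩
  let s : ∀ n, S n := fun n => Nat.rec s₀ next n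
  have hs : ∀ n, ∀ k < n, (s (n + 1)).1.1 k = (s n).1.1 k := fun n => hnext n (s n)
  have hs' : ∀ n, ∀ k < n, (s (k + 1)).1.1 k = (s n).1.1 k := by
    intro n
    induction n with
    | zero => simp
    | succ n ih =>
      intro k hk
      rcases Nat.lt_succ_iff_lt_or_eq.1 hk with hk | rfl
      · rw [hs n k hk, ih k hk]
      · rfl
  refine ⟨fun k => (s (k + 1)).1.1 k, fun n => ⟨(s n).1.2, ?_⟩⟩
  have h := (s n).2
  have hsimp : ∀ {x L}, IsNerveSimplex n (fun k => (s (k + 1)).1.1 k) x L →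
      IsNerveSimplex n (s n).1.1 x L := fun hL =>
    ⟨hL.lt, hL.injOn, fun a ha => by
      rw [← hs' n _ (hL.lt a ha)]
      exact hL.mem_closure a ha⟩
  refine ⟨fun k hk => ?_, fun k hk => ?_, fun k hk => ?_,
    fun L x hLne hL => h.continuousOn L x hLne (hsimp hL),
    fun L x hLne hL => h.mapsTo L x hLne (hsimp hL)⟩
  · rw [hs' n k hk]
    exact h.isOpen k hk
  · rw [hs' n k hk]
    exact h.cover k hk
  · rw [hs' n k hk]
    exact h.locallyFinite k hk

/-- Disjoint open families refining the covers of a nerve map yield a selection. -/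
theorem IsNerveMap.exists_selection [T2Space X] [ParacompactSpace X] {φ : ℕ → X → Set Y}
    (hasph : ∀ k x, EmbedIn k (φ k x) (φ (k + 1) x)) {n : ℕ} {U : ℕ → X → Set X}
    {Γ : (ℕ × X → ℝ) → Y} (h : IsNerveMap φ n U Γ) (hU : DisjointlyCovers U 0 n univ) :
    ∃ f : X → Y, Continuous f ∧ ∀ x, f x ∈ φ n x := by
  classical
  obtain ⟨D, hDo, hDU, hDd, hDc⟩ := hU
  let E : ℕ × X → Set X := fun a => if a.1 < n then D a.1 a.2 else ∅
  have hE : ∀ {a x}, x ∈ E a → a.1 < n ∧ x ∈ D a.1 a.2 := fun {a x} hx => by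
    by_cases ha : a.1 < n
    · exact ⟨ha, by simpa only [E, ha, if_true] using hx⟩
    · simp only [E, ha, if_false, mem_empty_iff_false] at hx
  have hEo : ∀ a, IsOpen (E a) := fun a => by
    by_cases ha : a.1 < n
    · simpa only [E, ha, if_true] using hDo _ _
    · simp only [E, ha, if_false, isOpen_empty]
  have hEf : LocallyFinite E := by
    intro x
    have hk : ∀ k : {k // k < n}, ∃ t ∈ 𝓝 x, {i | (U k i ∩ t).Nonempty}.Finite :=
      fun k => h.locallyFinite k k.2 x
    choose t ht htf using hk
    have : Finite {k // k < n} := (finite_lt_nat n).to_subtype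
    refine ⟨⋂ k, t k, Filter.iInter_mem.2 ht, (finite_iUnion fun k => (htf k).image
      (Prod.mk (k : ℕ))).subset ?_⟩
    rintro a ⟨z, hz, hzt⟩
    obtain ⟨ha, hz⟩ := hE hz
    exact mem_iUnion.2 ⟨⟨a.1, ha⟩, a.2, ⟨z, hDU _ _ hz, mem_iInter.1 hzt _⟩, rfl⟩
  have hEc : (univ : Set X) ⊆ ⋃ a, E a := fun x hx => by
    obtain ⟨k, -, hk, i, hi⟩ := hDc x hx
    exact mem_iUnion.2 ⟨(k, i), by simpa only [E, hk, if_true] using hi⟩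
  obtain ⟨ρ, hρ⟩ := PartitionOfUnity.exists_isSubordinate_of_locallyFinite isClosed_univ E hEo
    hEf hEc
  have hLs : ∀ x, IsNerveSimplex n U x (ρ.fintsupport x) := fun x => by
    have hmem : ∀ a ∈ ρ.fintsupport x, a.1 < n ∧ x ∈ D a.1 a.2 := fun a ha =>
      hE (hρ a ((ρ.mem_fintsupport_iff x a).1 ha))
    refine ⟨fun a ha => (hmem a ha).1, ?_, fun a ha => subset_closure (hDU _ _ (hmem a ha).2)⟩
    rintro ⟨k, i⟩ ha ⟨l, j⟩ hb (rfl : k = l)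
    by_contra hne
    exact disjoint_left.1 (hDd k i j fun hij => hne (by rw [hij])) (hmem _ ha).2 (hmem _ hb).2
  have hev : ∀ x, ∀ᶠ y in 𝓝 x, (fun a => ρ a y) ∈ vertexSimplex (ρ.fintsupport x) := fun x => by
    filter_upwards [ρ.eventually_finsupport_subset x] with y hy
    refine ⟨fun a => ρ.nonneg a y, fun a ha => ?_, ρ.sum_finsupport' (mem_univ y) hy⟩
    by_contra hne
    exact ha (hy ((ρ.mem_finsupport y).2 hne))
  have hLne : ∀ x, (ρ.fintsupport x).Nonempty := fun x => by
    rw [Finset.nonempty_iff_ne_empty]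
    intro h0
    have := (hev x).self_of_nhds.2.2
    rw [h0, Finset.sum_empty] at this
    exact zero_ne_one this
  refine ⟨fun x => Γ fun a => ρ a x, continuous_iff_continuousAt.2 fun x => ?_, fun x => ?_⟩
  · have hc : ContinuousOn (fun y => Γ fun a => ρ a y)
        {y | (fun a => ρ a y) ∈ vertexSimplex (ρ.fintsupport x)} :=
      (h.continuousOn _ x (hLne x) (hLs x)).comp
        (continuous_pi fun a => (ρ a).continuous).continuousOn fun _ hy => hy
    exact hc.continuousAt (hev x)
  · have hmono : Monotone fun k => φ k x := monotone_nat_of_le_succ fun k => (hasph k x).subset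
    refine hmono ?_ (h.mapsTo _ x (hLne x) (hLs x) (hev x).self_of_nhds)
    have := (hLs x).card_le
    omega

end Stages

/-- On a paracompact Hausdorff finite C-space, every aspherical sequence of lower locally
constant mappings into a Hausdorff space has a member admitting a continuous selection. -/
theorem asphericalSequence_member_selection_of_finiteCSpace
    {X : Type*} [TopologicalSpace X] [T2Space X] [ParacompactSpace X]
    (hX : IsFiniteCSpace X)
    {Y : Type*} [TopologicalSpace Y] [T2Space Y] (φ : ℕ → X → Set Y)
    (hne : ∀ k x, (φ k x).Nonempty)
    (hllc : ∀ k, LowerLocallyConstant (φ k))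
    (hasph : ∀ k x, EmbedIn k (φ k x) (φ (k + 1) x)) :
    ∃ n : ℕ, ∃ f : X → Y, Continuous f ∧ ∀ x, f x ∈ φ n x := by
  rcases isEmpty_or_nonempty X with hX₀ | ⟨⟨x₀⟩⟩
  · exact ⟨0, isEmptyElim, continuous_of_const fun x => isEmptyElim x, isEmptyElim⟩
  have : Nonempty Y := ⟨(hne 0 x₀).some⟩
  obtain ⟨U, hU⟩ := exists_forall_isNerveMap hne hllc hasph
  obtain ⟨n, hn⟩ := hX.disjointlyCovers_of_paracompact U
    (fun k => (hU (k + 1)).choose_spec.isOpen k k.lt_succ_self)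
    (fun k => (hU (k + 1)).choose_spec.cover k k.lt_succ_self)
  obtain ⟨Γ, hΓ⟩ := hU n
  exact ⟨n, hΓ.exists_selection hasph hn⟩
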